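/- For all 1 ≤ i, j ≤ n and all m, p ∈ ℤ, [Σ_{k=i+1}^{n} (a_{i+1,k} a*_{ik})_m , Σ_{l=j+1}^{n} (a_{j+1,l} a*_{jl})_p] = δ_{i,j−1} Σ_{l=i+2}^{n} (a_{i+2,l} a*_{il})_{m+p} − δ_{j,i−1} Σ_{l=j+2}^{n} (a_{j+2,l} a*_{jl})_{m+p} as linear operators on ℂ[x]. -/

import Mathlib

open MvPolynomial

/-- Index type for the variables `x_{ij,m}`, `1 ≤ i ≤ j ≤ n`, `m ∈ ℤ`
(only the indices with `i ≤ j` are ever used). -/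
abbrev XIdx (n : ℕ) := Fin n × Fin n × ℤ

/-- The Fock space `ℂ[x]`. -/
abbrev Px (n : ℕ) := MvPolynomial (XIdx n) ℂ

/-- The oscillator operator `a_{ij,m}` on `ℂ[x]`:  `∂/∂x_{ij,m}` if `m ≥ 0` and `j ≤ r`,
multiplication by `x_{ij,m}` otherwise. -/
noncomputable def aOp (n r : ℕ) (i j : Fin n) (m : ℤ) : Module.End ℂ (Px n) :=
  if 0 ≤ m ∧ (j : ℕ) + 1 ≤ r then (pderiv (i, j, m)).toLinearMap
  else LinearMap.mulLeft ℂ (X (i, j, m))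

/-- The oscillator operator `a*_{ij,m}` on `ℂ[x]`:  multiplication by `x_{ij,-m}` if `m ≤ 0`
and `j ≤ r`, and `-∂/∂x_{ij,-m}` otherwise. -/
noncomputable def aStar (n r : ℕ) (i j : Fin n) (m : ℤ) : Module.End ℂ (Px n) :=
  if m ≤ 0 ∧ (j : ℕ) + 1 ≤ r then LinearMap.mulLeft ℂ (X (i, j, -m))
  else - (pderiv (i, j, -m)).toLinearMap

/-- The quadratic operator `(a_{kl} a*_{k'l'})_m = Σ_{q∈ℤ} a_{kl,q} a*_{k'l',m-q}`
(pointwise `finsum`). -/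
noncomputable def pairOp (n r : ℕ) (k l k' l' : Fin n) (m : ℤ) (P : Px n) : Px n :=
  ∑ᶠ q : ℤ, aOp n r k l q (aStar n r k' l' (m - q) P)

/-- `Σ_{k=1}^{i-1} (a_{k,i-1} a*_{k,i})_m`. -/
noncomputable def sumLow (n r : ℕ) (i : Fin n) (m : ℤ) (P : Px n) : Px n :=
  ∑ k : Fin n, if h : k < i then
    pairOp n r k (⟨(i : ℕ) - 1, by have := i.isLt; omega⟩ : Fin n) k i m P
  else 0

/-- `Σ_{k=i+1}^{n} (a_{i+1,k} a*_{i,k})_m`. -/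
noncomputable def sumHigh (n r : ℕ) (i : Fin n) (m : ℤ) (P : Px n) : Px n :=
  ∑ k : Fin n, if h : i < k then
    pairOp n r (⟨(i : ℕ) + 1, by have := k.isLt; have := Fin.lt_def.mp h; omega⟩ : Fin n)
      k i k m P
  else 0

/-- `Σ_{l=i+2}^{n} (a_{i+2,l} a*_{i,l})_m`. -/
noncomputable def sumHigh2 (n r : ℕ) (i : Fin n) (m : ℤ) (P : Px n) : Px n :=
  ∑ l : Fin n, if h : (i : ℕ) + 2 ≤ (l : ℕ) then
    pairOp n r (⟨(i : ℕ) + 2, by have := l.isLt; omega⟩ : Fin n) l i l m P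
  else 0

section Oscillators

variable {n r : ℕ}

lemma pderiv_pderiv_comm {σ R : Type*} [CommRing R] (i j : σ) (P : MvPolynomial σ R) :
    pderiv i (pderiv j P) = pderiv j (pderiv i P) := by
  have h : ⁅pderiv (R := R) i, pderiv (R := R) j⁆ = 0 := by
    classical
    refine MvPolynomial.derivation_ext fun k => ?_
    simp [Derivation.commutator_apply, pderiv_X, Pi.single_apply, apply_ite]
  have h' := DFunLike.congr_fun h P
  simpa [Derivation.commutator_apply, sub_eq_zero] using h'

lemma aOp_comm (i j k l : Fin n) (s t : ℤ) (P : Px n) :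
    aOp n r i j s (aOp n r k l t P) = aOp n r k l t (aOp n r i j s P) := by
  unfold aOp
  split_ifs with h₁ h₂ h₂
  · exact pderiv_pderiv_comm _ _ _
  · have : (k, l, t) ≠ (i, j, s) := by rintro ⟨⟩; exact h₂ h₁
    simp [pderiv_X_of_ne this]
  · have : (i, j, s) ≠ (k, l, t) := by rintro ⟨⟩; exact h₁ h₂
    simp [pderiv_X_of_ne this]
  · exact mul_left_comm _ _ _

lemma aStar_comm (i j k l : Fin n) (s t : ℤ) (P : Px n) :
    aStar n r i j s (aStar n r k l t P) = aStar n r k l t (aStar n r i j s P) := by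
  unfold aStar
  split_ifs with h₁ h₂ h₂
  · exact mul_left_comm _ _ _
  · have : (i, j, -s) ≠ (k, l, -t) := by
      intro h; simp only [Prod.mk.injEq, neg_inj] at h; obtain ⟨rfl, rfl, rfl⟩ := h; exact h₂ h₁
    simp [pderiv_X_of_ne this]
  · have : (k, l, -t) ≠ (i, j, -s) := by
      intro h; simp only [Prod.mk.injEq, neg_inj] at h; obtain ⟨rfl, rfl, rfl⟩ := h; exact h₁ h₂
    simp [pderiv_X_of_ne this]
  · simpa using pderiv_pderiv_comm _ _ _

/-- The canonical commutation relation between `a` and `a*`. -/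
lemma aOp_aStar (i j k l : Fin n) (s t : ℤ) (P : Px n) :
    aOp n r i j s (aStar n r k l t P) = aStar n r k l t (aOp n r i j s P) +
      if i = k ∧ j = l ∧ s + t = 0 then P else 0 := by
  by_cases h : i = k ∧ j = l ∧ s + t = 0
  · obtain ⟨rfl, rfl, hst⟩ := h
    obtain rfl : t = -s := by omega
    by_cases h : 0 ≤ s ∧ (j : ℕ) + 1 ≤ r
    · simp [aOp, aStar, h, add_comm]
    · simp only [aOp, aStar, neg_nonpos, if_neg h]
      simp
  · rw [if_neg h, add_zero]
    have h₁ : (i, j, s) ≠ (k, l, -t) := by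
      intro e; simp only [Prod.mk.injEq] at e; exact h ⟨e.1, e.2.1, by omega⟩
    unfold aOp aStar
    split_ifs
    · simp [pderiv_X_of_ne h₁.symm]
    · simpa using pderiv_pderiv_comm _ _ _
    · exact mul_left_comm _ _ _
    · simp [pderiv_X_of_ne h₁]

lemma mem_vars_of_aOp_ne_zero {i j : Fin n} {s : ℤ} {P : Px n} (hs : 0 ≤ s) (hj : (j : ℕ) + 1 ≤ r)
    (h : aOp n r i j s P ≠ 0) : (i, j, s) ∈ P.vars := by
  contrapose! h
  simpa [aOp, hs, hj] using pderiv_eq_zero_of_notMem_vars h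

lemma mem_vars_of_aStar_ne_zero {i j : Fin n} {s : ℤ} {P : Px n}
    (hs : ¬(s ≤ 0 ∧ (j : ℕ) + 1 ≤ r)) (h : aStar n r i j s P ≠ 0) : (i, j, -s) ∈ P.vars := by
  contrapose! h
  rw [aStar, if_neg hs, LinearMap.neg_apply, neg_eq_zero]
  exact pderiv_eq_zero_of_notMem_vars h

lemma finite_support_pair {k k' : Fin n} (hk : k ≠ k') (l : Fin n) (m : ℤ) (P : Px n) :
    (Function.support fun q : ℤ => aOp n r k l q (aStar n r k' l (m - q) P)).Finite := by
  have h₁ : {q : ℤ | (k, l, q) ∈ P.vars}.Finite :=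
    P.vars.finite_toSet.preimage fun x _ y _ h => by simpa using h
  have h₂ : {q : ℤ | (k', l, -(m - q)) ∈ P.vars}.Finite :=
    P.vars.finite_toSet.preimage fun x _ y _ h => by simpa using h
  refine ((h₁.union h₂).union (Set.finite_Ico m 0)).subset fun q hq => ?_
  rw [Function.mem_support] at hq
  have hstar : aStar n r k' l (m - q) P ≠ 0 := fun h => hq (by rw [h, map_zero])
  by_cases hm : m - q ≤ 0 ∧ (l : ℕ) + 1 ≤ r
  · by_cases h0 : 0 ≤ q
    · refine .inl (.inl (mem_vars_of_aOp_ne_zero h0 hm.2 fun h => hq ?_))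
      simp [aOp_aStar, h, hk]
    · exact .inr ⟨by omega, by omega⟩
  · exact .inl (.inr (mem_vars_of_aStar_ne_zero hm hstar))

/-- The operator `(a_{kl} a*_{k'l})_m` for `k ≠ k'`, as a linear map. -/
noncomputable def pairEnd (r : ℕ) {k k' : Fin n} (hk : k ≠ k') (l : Fin n) (m : ℤ) :
    Module.End ℂ (Px n) where
  toFun := pairOp n r k l k' l m
  map_add' P Q := by
    simp only [pairOp, map_add]
    exact finsum_add_distrib (finite_support_pair hk l m P) (finite_support_pair hk l m Q)
  map_smul' c P := by
    simp only [pairOp, map_smul, RingHom.id_apply]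
    exact (smul_finsum' c (finite_support_pair hk l m P)).symm

lemma pairEnd_apply {k k' : Fin n} (hk : k ≠ k') (l : Fin n) (m : ℤ) (P : Px n) :
    pairEnd r hk l m P = ∑ᶠ q : ℤ, aOp n r k l q (aStar n r k' l (m - q) P) := rfl

lemma map_pairEnd {k k' : Fin n} (hk : k ≠ k') (l : Fin n) (m : ℤ) (f : Module.End ℂ (Px n))
    (P : Px n) :
    f (pairEnd r hk l m P) = ∑ᶠ q : ℤ, f (aOp n r k l q (aStar n r k' l (m - q) P)) :=
  f.toAddMonoidHom.map_finsum (finite_support_pair hk l m P)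

lemma finite_support_map_pair {k k' : Fin n} (hk : k ≠ k') (l : Fin n) (m : ℤ)
    (f : Module.End ℂ (Px n)) (P : Px n) :
    (Function.support fun q : ℤ => f (aOp n r k l q (aStar n r k' l (m - q) P))).Finite :=
  (finite_support_pair hk l m P).subset fun q hq h => hq (by
    simp only at h ⊢; rw [h, map_zero])

lemma finsum_add_ite_eq {α M : Type*} [DecidableEq α] [AddCommMonoid M] {f : α → M}
    (hf : f.support.Finite) (p : Prop) [Decidable p] (a : α) (g : α → M) :
    ∑ᶠ x, (f x + if p ∧ x = a then g x else 0) = ∑ᶠ x, f x + if p then g a else 0 := by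
  have hs : ∀ x, x ≠ a → (if p ∧ x = a then g x else 0) = 0 := fun x hx => by simp [hx]
  rw [finsum_add_distrib hf, finsum_eq_single _ a hs]
  · simp
  · exact (Set.finite_singleton a).subset fun x hx => by_contra fun h => hx (hs x h)

lemma pairEnd_aOp {a b : Fin n} (hab : a ≠ b) (k c l : Fin n) (m s : ℤ) (P : Px n) :
    pairEnd r hab k m (aOp n r c l s P) = aOp n r c l s (pairEnd r hab k m P) +
      if c = b ∧ l = k then -aOp n r a k (m + s) P else 0 := by
  rw [map_pairEnd, pairEnd_apply,
    ← finsum_add_ite_eq (finite_support_map_pair hab k m _ P) _ _ fun q => -aOp n r a k q P]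
  refine finsum_congr fun q => ?_
  have hq : (c = b ∧ l = k ∧ s + (m - q) = 0) ↔ ((c = b ∧ l = k) ∧ q = m + s) := by
    rw [and_assoc]; refine and_congr_right fun _ => and_congr_right fun _ => ?_; omega
  rw [aOp_comm c l a k, aOp_aStar c l b k, map_add]
  simp only [hq]
  split_ifs <;> simp

lemma pairEnd_aStar {a b : Fin n} (hab : a ≠ b) (k d l : Fin n) (m t : ℤ) (P : Px n) :
    pairEnd r hab k m (aStar n r d l t P) = aStar n r d l t (pairEnd r hab k m P) +
      if a = d ∧ k = l then aStar n r b k (m + t) P else 0 := by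
  rw [map_pairEnd, pairEnd_apply, ← sub_neg_eq_add m t,
    ← finsum_add_ite_eq (finite_support_map_pair hab k m _ P) _ _
      fun q => aStar n r b k (m - q) P]
  refine finsum_congr fun q => ?_
  have hq : (a = d ∧ k = l ∧ q + t = 0) ↔ ((a = d ∧ k = l) ∧ q = -t) := by
    rw [and_assoc]; refine and_congr_right fun _ => and_congr_right fun _ => ?_; omega
  rw [aStar_comm b k d l, aOp_aStar a k d l]
  simp only [hq]

lemma pairEnd_pairEnd {a b c d : Fin n} (hab : a ≠ b) (hcd : c ≠ d) (h : ¬(a = d ∧ c = b))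
    (k l : Fin n) (m p : ℤ) (P : Px n) :
    pairEnd r hab k m (pairEnd r hcd l p P) - pairEnd r hcd l p (pairEnd r hab k m P) =
      if k = l then
        (if a = d then pairOp n r c k b k (m + p) P else 0) -
          (if c = b then pairOp n r a k d k (m + p) P else 0)
      else 0 := by
  have key (s : ℤ) : pairEnd r hab k m (aOp n r c l s (aStar n r d l (p - s) P)) =
      aOp n r c l s (aStar n r d l (p - s) (pairEnd r hab k m P)) +
        ((if a = d ∧ k = l then aOp n r c l s (aStar n r b k (m + p - s) P) else 0) -
          if c = b ∧ l = k then aOp n r a k (m + s) (aStar n r d l (p - s) P) else 0) := by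
    rw [pairEnd_aOp, pairEnd_aStar, map_add, add_assoc, add_sub_assoc m p s]
    congr 1
    split_ifs <;> simp [sub_eq_add_neg]
  rw [map_pairEnd, finsum_congr key, sub_eq_iff_eq_add', pairEnd_apply hcd]
  by_cases hkl : k = l
  · subst hkl
    by_cases had : a = d
    · have hcb : c ≠ b := fun e => h ⟨had, e⟩
      simp only [had, hcb, if_true, if_false, and_true, sub_zero]
      exact finsum_add_distrib (finite_support_pair hcd k p _) (finite_support_pair hcb k _ P)
    · by_cases hcb : c = b
      · subst hcb
        have hshift : (fun s => aOp n r a k (m + s) (aStar n r d k (p - s) P)) =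
            (fun q => aOp n r a k q (aStar n r d k (m + p - q) P)) ∘ Equiv.addLeft m := by
          funext s
          simp [show m + p - (m + s) = p - s by ring]
        simp only [had, if_true, if_false, and_true, zero_sub, ← sub_eq_add_neg]
        rw [finsum_sub_distrib (finite_support_pair hcd k p _), hshift]
        · exact congrArg _ (finsum_comp_equiv (Equiv.addLeft m)
            (f := fun q => aOp n r a k q (aStar n r d k (m + p - q) P)))
        · rw [hshift]
          exact (finite_support_pair had k _ P).preimage (Equiv.injective _).injOn
      · simp [had, hcb]
  · simp [hkl, Ne.symm hkl]

/-- The `k`-th summand of `sumHigh`, as a linear map. -/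
noncomputable def highTerm (r : ℕ) (i : Fin n) (m : ℤ) (k : Fin n) : Module.End ℂ (Px n) :=
  if h : i < k then
    pairEnd r (k := ⟨(i : ℕ) + 1, by have := k.isLt; have := Fin.lt_def.mp h; omega⟩) (k' := i)
      (by simp [Fin.ext_iff]) k m
  else 0

/-- The `l`-th summand of `sumHigh2`. -/
noncomputable def highTerm₂ (r : ℕ) (i : Fin n) (m : ℤ) (P : Px n) (l : Fin n) : Px n :=
  if h : (i : ℕ) + 2 ≤ (l : ℕ) then
    pairOp n r (⟨(i : ℕ) + 2, by have := l.isLt; omega⟩ : Fin n) l i l m P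
  else 0

lemma sumHigh_eq (i : Fin n) (m : ℤ) (P : Px n) :
    sumHigh n r i m P = (∑ k, highTerm r i m k) P := by
  rw [LinearMap.sum_apply]
  refine Finset.sum_congr rfl fun k _ => ?_
  unfold highTerm
  split_ifs <;> rfl

lemma highTerm_commutator (i j : Fin n) (m p : ℤ) (k l : Fin n) (P : Px n) :
    highTerm r i m k (highTerm r j p l P) - highTerm r j p l (highTerm r i m k P) =
      if k = l then
        (if (i : ℕ) + 1 = (j : ℕ) then highTerm₂ r i (m + p) P k else 0) -
          (if (j : ℕ) + 1 = (i : ℕ) then highTerm₂ r j (m + p) P k else 0)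
      else 0 := by
  by_cases hi : i < k
  · by_cases hj : j < l
    · rw [highTerm, highTerm, dif_pos hi, dif_pos hj, pairEnd_pairEnd]
      · refine if_ctx_congr Iff.rfl (fun hkl => ?_) fun _ => rfl
        subst hkl
        rw [Fin.lt_def] at hi hj
        congr 1
        · refine if_ctx_congr (by simp [Fin.ext_iff]) (fun e => ?_) fun _ => rfl
          rw [highTerm₂, dif_pos (by omega)]
          congr 1
          simp only [Fin.mk.injEq]; omega
        · refine if_ctx_congr (by simp [Fin.ext_iff]) (fun e => ?_) fun _ => rfl
          rw [highTerm₂, dif_pos (by omega)]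
          congr 1
          simp only [Fin.mk.injEq]; omega
      · simp only [Fin.ext_iff]; omega
    · have h0 : highTerm r j p l = 0 := dif_neg hj
      rw [Fin.lt_def] at hj
      simp only [h0, highTerm₂]
      split_ifs <;> first | (subst_vars; omega) | simp
  · have h0 : highTerm r i m k = 0 := dif_neg hi
    rw [Fin.lt_def] at hi
    simp only [h0, highTerm₂]
    split_ifs <;> first | (subst_vars; omega) | simp

end Oscillators

/-- `[Σ_{k>i} (a_{i+1,k} a*_{ik})_m , Σ_{l>j} (a_{j+1,l} a*_{jl})_p]
 = δ_{i,j−1} Σ_{l≥i+2} (a_{i+2,l} a*_{il})_{m+p} − δ_{j,i−1} Σ_{l≥j+2} (a_{j+2,l} a*_{jl})_{m+p}`. -/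
theorem sumHigh_sumHigh_commutator (n r : ℕ) (hn : 1 ≤ n) (hr : r ≤ n)
    (i j : Fin n) (m p : ℤ) (P : Px n) :
    sumHigh n r i m (sumHigh n r j p P) - sumHigh n r j p (sumHigh n r i m P) =
      (if (i : ℕ) + 1 = (j : ℕ) then sumHigh2 n r i (m + p) P else 0)
        - (if (j : ℕ) + 1 = (i : ℕ) then sumHigh2 n r j (m + p) P else 0) := by
  simp only [sumHigh_eq, LinearMap.sum_apply, map_sum]
  rw [Finset.sum_comm (γ := Fin n), ← Finset.sum_sub_distrib]
  simp only [← Finset.sum_sub_distrib, highTerm_commutator, Finset.sum_ite_eq, Finset.mem_univ,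
    if_true]
  rw [Finset.sum_sub_distrib]
  congr 1 <;> split_ifs <;> first | rfl | simp
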